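/- Let C be a polyhedral cone in ℝ^d (the cone generated by finitely many vectors) and let F be a face of C. Then the dual cone of F equals C* + F^⊥; that is, F* = {ξ + η : ξ ∈ C*, ⟨η,x⟩ = 0 for all x ∈ F}. In particular, the image of C* under the orthogonal projection ℝ^d → lin(F) coincides with the image of F* under the same projection (the transverse cone of C* along its face corresponding to F equals the projected dual cone of F). -/

import Mathlib

open scoped RealInnerProductSpace

/-- The dual cone of a subset of `ℝ^d`. -/
def dualSet {d : ℕ} (c : Set (EuclideanSpace ℝ (Fin d))) : Set (EuclideanSpace ℝ (Fin d)) :=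
  {ξ | ∀ x ∈ c, 0 ≤ ⟪ξ, x⟫}

/-- A face of a cone `c` is a subset of the form `c ∩ ξ^⊥` with `ξ ∈ c*`
(this includes `c` itself, taking `ξ = 0`). -/
def IsFaceOf {d : ℕ} (c F : Set (EuclideanSpace ℝ (Fin d))) : Prop :=
  ∃ ξ ∈ dualSet c, F = {x ∈ c | ⟪ξ, x⟫ = 0}

/-- for a face `F` of a polyhedral cone `C`, the dual cone of `F` equals
`C* + F^⊥`; in particular the images of `C*` and of `F*` under the orthogonal projection
onto `lin(F)` coincide. -/
theorem dual_of_face_eq_dual_add_perp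
    (d k : ℕ) (v : Fin k → EuclideanSpace ℝ (Fin d))
    (C : Set (EuclideanSpace ℝ (Fin d)))
    (hC : C = {x | ∃ t : Fin k → ℝ, (∀ i, 0 ≤ t i) ∧ x = ∑ i, t i • v i})
    (F : Set (EuclideanSpace ℝ (Fin d)))
    (hF : IsFaceOf C F) :
    dualSet F =
      {y | ∃ ξ ∈ dualSet C, ∃ η : EuclideanSpace ℝ (Fin d),
        (∀ x ∈ F, ⟪η, x⟫ = 0) ∧ y = ξ + η} ∧
    (Submodule.orthogonalProjectionOnto (Submodule.span ℝ F)) '' dualSet C =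
      (Submodule.orthogonalProjectionOnto (Submodule.span ℝ F)) '' dualSet F := by
  obtain ⟨ξ₀, hξ₀, hFe⟩ := hF
  have hvC : ∀ i, v i ∈ C := by
    intro i
    rw [hC]
    refine ⟨Pi.single i 1, ?_, ?_⟩
    · intro j
      by_cases h : j = i
      · subst h; simp
      · simp [h]
    · simp [Pi.single_apply, ite_smul]
  have hFC : F ⊆ C := by
    intro x hx
    rw [hFe] at hx
    exact hx.1
  have key : ∀ y ∈ dualSet F, ∃ ξ ∈ dualSet C, ∃ η : EuclideanSpace ℝ (Fin d),
        (∀ x ∈ F, ⟪η, x⟫ = 0) ∧ y = ξ + η := by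
    intro y hy
    set N : ℝ := ∑ i, |⟪y, v i⟫| / ⟪ξ₀, v i⟫ with hN
    have hpos : ∀ i, 0 ≤ ⟪y + N • ξ₀, v i⟫ := by
      intro i
      rw [inner_add_left, real_inner_smul_left]
      rcases (hξ₀ _ (hvC i)).eq_or_lt with h | h
      · rw [← h, mul_zero, add_zero]
        apply hy
        rw [hFe]
        exact ⟨hvC i, h.symm⟩
      · have h1 : |⟪y, v i⟫| / ⟪ξ₀, v i⟫ ≤ N :=
          Finset.single_le_sum (f := fun i => |⟪y, v i⟫| / ⟪ξ₀, v i⟫)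
            (fun j _ => div_nonneg (abs_nonneg _) (hξ₀ _ (hvC j))) (Finset.mem_univ i)
        rw [div_le_iff₀ h] at h1
        have h2 := neg_abs_le (⟪y, v i⟫)
        linarith
    refine ⟨y + N • ξ₀, ?_, -(N • ξ₀), ?_, by abel⟩
    · intro x hx
      rw [hC] at hx
      obtain ⟨t, ht, rfl⟩ := hx
      rw [inner_sum]
      refine Finset.sum_nonneg fun i _ => ?_
      rw [real_inner_smul_right]
      exact mul_nonneg (ht i) (hpos i)
    · intro x hx
      rw [hFe] at hx
      rw [inner_neg_left, real_inner_smul_left, hx.2, mul_zero, neg_zero]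
  have hsub : dualSet C ⊆ dualSet F := fun ξ hξ x hx => hξ x (hFC hx)
  refine ⟨?_, ?_⟩
  · apply Set.Subset.antisymm
    · exact key
    · rintro y ⟨ξ, hξ, η, hη, rfl⟩ x hx
      rw [inner_add_left, hη x hx, add_zero]
      exact hξ x (hFC hx)
  · apply Set.Subset.antisymm
    · exact Set.image_mono hsub
    · rintro _ ⟨y, hy, rfl⟩
      obtain ⟨ξ, hξ, η, hη, rfl⟩ := key y hy
      refine ⟨ξ, hξ, ?_⟩
      have h0 : (Submodule.span ℝ F).orthogonalProjectionOnto η = 0 := by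
        rw [Submodule.orthogonalProjectionOnto_eq_zero_iff]
        rw [Submodule.mem_orthogonal']
        intro u hu
        induction hu using Submodule.span_induction with
        | mem x hx => exact hη x hx
        | zero => simp
        | add a b _ _ ha hb => rw [inner_add_right, ha, hb, add_zero]
        | smul c a _ ha => rw [real_inner_smul_right, ha, mul_zero]
      rw [map_add, h0, add_zero]
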